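/- Let K ⊂ ℝ^d be a compact convex set, μ a probability measure with supp(μ) ⊂ K, F ⊂ K a closed nonempty set, and x, y ∈ K. Then every geodesic γ ∈ Γ_F(x,y) (i.e. D_μ(γ) = D_{μ,F}(x,y)) satisfies |γ| ≤ λ · diam(K), where λ = 2c·ρ^{β+1}/(ρ − 1) with c = (16·5^β + 1152·165^β)/m^{2+β} and ρ = 1 + 32/m. -/

import Mathlib

open MeasureTheory Metric Set ProbabilityTheory
open scoped ENNReal NNReal

noncomputable section

/-- Euclidean space `ℝ^d`. -/
abbrev Euc (d : ℕ) := EuclideanSpace ℝ (Fin d)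

/-- The pseudo-distance-to-measure `δ_{μ,u}(x) = inf {r > 0 : μ(B(x,r)) > u}`. -/
def pseudoDTM {d : ℕ} (μ : Measure (Euc d)) (u : ℝ) (x : Euc d) : ℝ :=
  sInf {r : ℝ | 0 < r ∧ u < (μ (ball x r)).toReal}

/-- The distance-to-measure `d_μ(x) = ((1/m) ∫₀^m δ_{μ,u}(x)^p du)^{1/p}`. -/
def dtm {d : ℕ} (m p : ℝ) (μ : Measure (Euc d)) (x : Euc d) : ℝ :=
  ((1 / m) * ∫ u in Ioc (0 : ℝ) m, pseudoDTM μ u x ^ p) ^ (1 / p)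

/-- A Lipschitz path. -/
def IsLipschitzPath {d : ℕ} (γ : ℝ → Euc d) : Prop := ∃ K, LipschitzWith K γ

/-- Euclidean length `|γ| = ∫₀¹ ‖γ'(t)‖ dt`. -/
def eucLength {d : ℕ} (γ : ℝ → Euc d) : ℝ := ∫ t in Icc (0 : ℝ) 1, ‖deriv γ t‖

/-- FDTM length `D_μ(γ) = ∫₀¹ d_μ(γ(t))^β ‖γ'(t)‖ dt`. -/
def fdtmLength {d : ℕ} (m p β : ℝ) (μ : Measure (Euc d)) (γ : ℝ → Euc d) : ℝ :=
  ∫ t in Icc (0 : ℝ) 1, dtm m p μ (γ t) ^ β * ‖deriv γ t‖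

/-- Admissible paths `Γ_F(x,y)`: Lipschitz paths from `x` to `y` which may leave the domain `F`
only along straight lines. -/
def AdmissiblePath {d : ℕ} (F : Set (Euc d)) (x y : Euc d) (γ : ℝ → Euc d) : Prop :=
  IsLipschitzPath γ ∧ γ 0 = x ∧ γ 1 = y ∧
    ∀ a b : ℝ, 0 ≤ a → b ≤ 1 →
      (∀ t ∈ Ioo a b, γ t ∉ F) →
      ∃ u : Euc d, ‖u‖ = 1 ∧
        ∀ᵐ t ∂(volume.restrict (Ioo a b)), deriv γ t = ‖deriv γ t‖ • u

/-- The Fermat distance-to-measure `D_{μ,F}(x,y) = inf_{γ ∈ Γ_F(x,y)} D_μ(γ)`. -/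
def fdtm {d : ℕ} (m p β : ℝ) (μ : Measure (Euc d)) (F : Set (Euc d)) (x y : Euc d) : ℝ :=
  sInf {L : ℝ | ∃ γ : ℝ → Euc d, AdmissiblePath F x y γ ∧ L = fdtmLength m p β μ γ}

/-- A geodesic: an admissible path realizing the FDTM. -/
def IsGeodesic {d : ℕ} (m p β : ℝ) (μ : Measure (Euc d)) (F : Set (Euc d)) (x y : Euc d)
    (γ : ℝ → Euc d) : Prop :=
  AdmissiblePath F x y γ ∧ fdtmLength m p β μ γ = fdtm m p β μ F x y

/-- FDTM length of the straight segment `[x,y]`. -/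
def segFDTM {d : ℕ} (m p β : ℝ) (μ : Measure (Euc d)) (x y : Euc d) : ℝ :=
  ‖x - y‖ * ∫ t in Icc (0 : ℝ) 1, dtm m p μ ((1 - t) • x + t • y) ^ β

/-- The explicit constant `λ = 2·c·ρ^{β+1}/(ρ−1)` with `c = (16·5^β + 1152·165^β)/m^{2+β}`
and `ρ = 1 + 32/m`. -/
def fdtmConst (m β : ℝ) : ℝ :=
  2 * ((16 * (5 : ℝ) ^ β + 1152 * (165 : ℝ) ^ β) / m ^ (2 + β)) * (1 + 32 / m) ^ (β + 1) /
    ((1 + 32 / m) - 1)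

/-- Support of a measure: points all of whose neighborhoods have positive mass. -/
def measSupport {d : ℕ} (μ : Measure (Euc d)) : Set (Euc d) :=
  {x | ∀ r : ℝ, 0 < r → 0 < μ (ball x r)}

/-- `(a,b)`-standard measure: `μ(B(x,r)) ≥ a·r^b` for `x ∈ supp(μ)` and `0 < r ≤ a^{-1/b}`. -/
def IsStandard {d : ℕ} (μ : Measure (Euc d)) (a b : ℝ) : Prop :=
  ∀ x ∈ measSupport μ, ∀ r : ℝ, 0 < r → r ≤ a ^ (-(1 / b)) → a * r ^ b ≤ (μ (ball x r)).toReal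

section DistanceToMeasure

variable {d : ℕ} {m p : ℝ} {μ : Measure (Euc d)}

lemma pseudoDTM_nonneg (u : ℝ) (x : Euc d) : 0 ≤ pseudoDTM μ u x :=
  Real.sInf_nonneg fun _ hr => hr.1.le

lemma pseudoDTM_le {u r : ℝ} {x : Euc d} (hr : 0 < r) (h : u < (μ (ball x r)).toReal) :
    pseudoDTM μ u x ≤ r :=
  csInf_le ⟨0, fun _ hs => hs.1.le⟩ ⟨hr, h⟩

lemma exists_lt_measure_ball [IsProbabilityMeasure μ] {u : ℝ} (hu : u < 1) (x : Euc d) :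
    ∃ r : ℝ, 0 < r ∧ u < (μ (ball x r)).toReal := by
  have hmono : Monotone fun n : ℕ => ball x (n : ℝ) :=
    fun i j hij => ball_subset_ball (by exact_mod_cast hij)
  have h := tendsto_measure_iUnion_atTop (μ := μ) hmono
  rw [iUnion_ball_nat, measure_univ] at h
  have h' := (ENNReal.tendsto_toReal ENNReal.one_ne_top).comp h
  rw [ENNReal.toReal_one] at h'
  obtain ⟨n, hn, hn'⟩ :=
    ((h'.eventually (lt_mem_nhds hu)).and (Filter.eventually_gt_atTop 0)).exists
  exact ⟨n, by exact_mod_cast hn', hn⟩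

lemma le_pseudoDTM [IsProbabilityMeasure μ] {u R : ℝ} {x : Euc d} (hu : u < 1)
    (h : (μ (ball x R)).toReal ≤ u) : R ≤ pseudoDTM μ u x := by
  refine le_csInf (exists_lt_measure_ball hu x) fun r hr => ?_
  by_contra! hlt
  exact absurd hr.2 (not_lt.2 ((ENNReal.toReal_mono (measure_ne_top _ _)
    (measure_mono (ball_subset_ball hlt.le))).trans h))

lemma pseudoDTM_mono [IsProbabilityMeasure μ] {u v : ℝ} (huv : u ≤ v) (hv : v < 1) (x : Euc d) :
    pseudoDTM μ u x ≤ pseudoDTM μ v x :=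
  csInf_le_csInf ⟨0, fun _ hs => hs.1.le⟩ (exists_lt_measure_ball hv x)
    fun _ hr => ⟨hr.1, huv.trans_lt hr.2⟩

lemma pseudoDTM_le_add_dist [IsProbabilityMeasure μ] {u : ℝ} (hu : u < 1) (x y : Euc d) :
    pseudoDTM μ u x ≤ pseudoDTM μ u y + dist x y := by
  rw [← sub_le_iff_le_add]
  refine le_csInf (exists_lt_measure_ball hu y) fun r hr => ?_
  rw [sub_le_iff_le_add]
  refine pseudoDTM_le (by linarith [hr.1, dist_nonneg (x := x) (y := y)]) (hr.2.trans_le ?_)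
  exact ENNReal.toReal_mono (measure_ne_top _ _)
    (measure_mono (ball_subset_ball' (by rw [dist_comm])))

lemma aestronglyMeasurable_pseudoDTM [IsProbabilityMeasure μ] (hm : m ∈ Ioo (0 : ℝ) 1)
    (x : Euc d) :
    AEStronglyMeasurable (fun u => pseudoDTM μ u x) (volume.restrict (Ioc 0 m)) :=
  (aemeasurable_restrict_of_monotoneOn measurableSet_Ioc fun _ _ _ hv huv =>
    pseudoDTM_mono huv (hv.2.trans_lt hm.2) x).aestronglyMeasurable

/-- The uniform probability measure on `(0, m]`. -/
def massMeasure (m : ℝ) : Measure ℝ := ENNReal.ofReal (1 / m) • volume.restrict (Ioc 0 m)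

lemma isProbabilityMeasure_massMeasure (hm : 0 < m) : IsProbabilityMeasure (massMeasure m) := by
  constructor
  simp only [massMeasure, Measure.smul_apply, Measure.restrict_apply MeasurableSet.univ, univ_inter,
    Real.volume_Ioc, smul_eq_mul, sub_zero]
  rw [← ENNReal.ofReal_mul (by positivity), one_div_mul_cancel hm.ne', ENNReal.ofReal_one]

lemma aestronglyMeasurable_pseudoDTM_massMeasure [IsProbabilityMeasure μ]
    (hm : m ∈ Ioo (0 : ℝ) 1) (x : Euc d) :
    AEStronglyMeasurable (fun u => pseudoDTM μ u x) (massMeasure m) :=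
  (aestronglyMeasurable_pseudoDTM hm x).smul_measure _

lemma ae_massMeasure_mem (m : ℝ) : ∀ᵐ u ∂massMeasure m, u ∈ Ioc 0 m :=
  Measure.ae_smul_measure (ae_restrict_mem measurableSet_Ioc) _

lemma memLp_pseudoDTM [IsProbabilityMeasure μ] (hm : m ∈ Ioo (0 : ℝ) 1) (q : ℝ≥0∞) (x : Euc d) :
    MemLp (fun u => pseudoDTM μ u x) q (massMeasure m) := by
  have := isProbabilityMeasure_massMeasure hm.1
  refine MemLp.of_bound (aestronglyMeasurable_pseudoDTM_massMeasure hm x) (pseudoDTM μ m x) ?_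
  filter_upwards [ae_massMeasure_mem m] with u hu
  rw [Real.norm_of_nonneg (pseudoDTM_nonneg u x)]
  exact pseudoDTM_mono hu.2 hm.2 x

lemma dtm_eq_lpNorm [IsProbabilityMeasure μ] (hm : m ∈ Ioo (0 : ℝ) 1) (hp : 1 ≤ p) (x : Euc d) :
    dtm m p μ x = lpNorm (fun u => pseudoDTM μ u x) (ENNReal.ofReal p) (massMeasure m) := by
  have hp0 : 0 < p := by linarith
  rw [lpNorm_eq_integral_norm_rpow_toReal (by simpa using hp0) ENNReal.ofReal_ne_top
    (aestronglyMeasurable_pseudoDTM_massMeasure hm x), ENNReal.toReal_ofReal hp0.le, massMeasure,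
    integral_smul_measure, ENNReal.toReal_ofReal (by have := hm.1; positivity), dtm, one_div p,
    smul_eq_mul]
  simp_rw [Real.norm_of_nonneg (pseudoDTM_nonneg _ x)]

lemma dtm_nonneg [IsProbabilityMeasure μ] (hm : m ∈ Ioo (0 : ℝ) 1) (hp : 1 ≤ p) (x : Euc d) :
    0 ≤ dtm m p μ x := by
  rw [dtm_eq_lpNorm hm hp]
  exact lpNorm_nonneg

lemma dtm_le_of_forall [IsProbabilityMeasure μ] (hm : m ∈ Ioo (0 : ℝ) 1) (hp : 1 ≤ p) {x : Euc d}
    {f : ℝ → ℝ} (hf : MemLp f (ENNReal.ofReal p) (massMeasure m))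
    (h : ∀ u ∈ Ioc 0 m, pseudoDTM μ u x ≤ f u) :
    dtm m p μ x ≤ lpNorm f (ENNReal.ofReal p) (massMeasure m) := by
  rw [dtm_eq_lpNorm hm hp, ← toReal_eLpNorm (aestronglyMeasurable_pseudoDTM_massMeasure hm x),
    ← toReal_eLpNorm hf.aestronglyMeasurable]
  refine ENNReal.toReal_mono hf.eLpNorm_ne_top (eLpNorm_mono_ae_real ?_)
  filter_upwards [ae_massMeasure_mem m] with u hu
  rw [Real.norm_of_nonneg (pseudoDTM_nonneg u x)]
  exact h u hu

lemma dtm_le_add_dist [IsProbabilityMeasure μ] (hm : m ∈ Ioo (0 : ℝ) 1) (hp : 1 ≤ p)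
    (x y : Euc d) : dtm m p μ x ≤ dtm m p μ y + dist x y := by
  have := isProbabilityMeasure_massMeasure hm.1
  have hp1 : (1 : ℝ≥0∞) ≤ ENNReal.ofReal p := by simpa using hp
  have hy := memLp_pseudoDTM (μ := μ) hm (ENNReal.ofReal p) y
  have hc : MemLp (fun _ : ℝ => dist x y) (ENNReal.ofReal p) (massMeasure m) := memLp_const _
  refine (dtm_le_of_forall hm hp (hy.add hc) fun u hu =>
    pseudoDTM_le_add_dist (hu.2.trans_lt hm.2) x y).trans ((lpNorm_add_le hy hp1).trans_eq ?_)
  rw [dtm_eq_lpNorm hm hp, lpNorm_const (zero_lt_one.trans_le hp1).ne' (NeZero.ne _)]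
  simp

lemma lipschitzWith_dtm [IsProbabilityMeasure μ] (hm : m ∈ Ioo (0 : ℝ) 1) (hp : 1 ≤ p) :
    LipschitzWith 1 (dtm m p μ : Euc d → ℝ) :=
  LipschitzWith.of_le_add (dtm_le_add_dist hm hp)

lemma dtm_le_of_measure_ball_eq_one [IsProbabilityMeasure μ] (hm : m ∈ Ioo (0 : ℝ) 1) (hp : 1 ≤ p)
    {x : Euc d} {R : ℝ} (hR : 0 < R) (h : μ (ball x R) = 1) : dtm m p μ x ≤ R := by
  have := isProbabilityMeasure_massMeasure hm.1
  have hp1 : (1 : ℝ≥0∞) ≤ ENNReal.ofReal p := by simpa using hp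
  refine (dtm_le_of_forall hm hp (memLp_const R) fun u hu => pseudoDTM_le hR ?_).trans_eq ?_
  · rw [h]
    exact hu.2.trans_lt hm.2
  · rw [lpNorm_const (zero_lt_one.trans_le hp1).ne' (NeZero.ne _)]
    simp [abs_of_pos hR]

lemma half_mass_lt_measure_ball [IsProbabilityMeasure μ] (hm : m ∈ Ioo (0 : ℝ) 1) (hp : 1 ≤ p)
    {x : Euc d} {r : ℝ} (h : dtm m p μ x < r) : m / 2 < (μ (ball x (2 * r))).toReal := by
  by_contra! hle
  have hm0 := hm.1
  have hr : 0 < r := (dtm_nonneg hm hp x).trans_lt h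
  have hp0 : 0 < p := by linarith
  have hint : IntegrableOn (fun u => pseudoDTM μ u x ^ p) (Ioc 0 m) := by
    refine IntegrableOn.of_bound (by simp)
      ((aestronglyMeasurable_pseudoDTM hm x).aemeasurable.pow_const p).aestronglyMeasurable
      (pseudoDTM μ m x ^ p) ?_
    filter_upwards [ae_restrict_mem measurableSet_Ioc] with u hu
    rw [Real.norm_of_nonneg (Real.rpow_nonneg (pseudoDTM_nonneg u x) p)]
    exact Real.rpow_le_rpow (pseudoDTM_nonneg u x) (pseudoDTM_mono hu.2 hm.2 x) hp0.le
  have hsub : Ioc (m / 2) m ⊆ Ioc 0 m := Ioc_subset_Ioc_left (by positivity)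
  have h1 : (m / 2) * (2 * r) ^ p ≤ ∫ u in Ioc (0 : ℝ) m, pseudoDTM μ u x ^ p := by
    calc (m / 2) * (2 * r) ^ p = ∫ _ in Ioc (m / 2) m, (2 * r) ^ p := by
          rw [setIntegral_const, smul_eq_mul, Real.volume_real_Ioc_of_le (by linarith)]
          ring
      _ ≤ ∫ u in Ioc (m / 2) m, pseudoDTM μ u x ^ p := by
          refine setIntegral_mono_on (by simp) (hint.mono_set hsub) measurableSet_Ioc fun u hu => ?_
          exact Real.rpow_le_rpow (by positivity)
            (le_pseudoDTM (hu.2.trans_lt hm.2) (hle.trans hu.1.le)) hp0.le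
      _ ≤ _ := setIntegral_mono_set hint
          (Filter.Eventually.of_forall fun u => Real.rpow_nonneg (pseudoDTM_nonneg u x) p)
          hsub.eventuallyLE
  have h2 : r ^ p ≤ (1 / m) * ∫ u in Ioc (0 : ℝ) m, pseudoDTM μ u x ^ p := by
    have h2p : (2 : ℝ) ≤ 2 ^ p := by
      simpa using Real.rpow_le_rpow_of_exponent_le (one_le_two (α := ℝ)) hp
    have hrp : 0 ≤ r ^ p := by positivity
    calc r ^ p ≤ (1 / m) * ((m / 2) * (2 * r) ^ p) := by
          rw [Real.mul_rpow two_pos.le hr.le]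
          field_simp
          nlinarith
      _ ≤ _ := by gcongr
  refine absurd h (not_lt.2 ?_)
  calc r = (r ^ p) ^ (1 / p) := by
        rw [← Real.rpow_mul hr.le, mul_one_div_cancel hp0.ne', Real.rpow_one]
    _ ≤ dtm m p μ x := Real.rpow_le_rpow (by positivity) h2 (by positivity)

/-- Sublevel sets of the distance-to-measure are covered by at most `2 / m` balls. -/
lemma exists_finset_cover_dtm_lt [IsProbabilityMeasure μ] (hm : m ∈ Ioo (0 : ℝ) 1) (hp : 1 ≤ p)
    {r : ℝ} : ∃ s : Finset (Euc d), (s.card : ℝ) * m ≤ 2 ∧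
      ∀ z, dtm m p μ z < r → ∃ c ∈ s, dist z c < 4 * r := by
  have hm0 := hm.1
  let P : Finset (Euc d) → Prop := fun s => (∀ z ∈ s, dtm m p μ z < r) ∧
    (s : Set (Euc d)).PairwiseDisjoint fun z => ball z (2 * r)
  have hcard : ∀ s, P s → (s.card : ℝ) * m ≤ 2 := by
    intro s hs
    have h1 : ∑ z ∈ s, μ (ball z (2 * r)) ≤ 1 := by
      rw [← measure_biUnion_finset hs.2 fun _ _ => measurableSet_ball]
      exact prob_le_one
    have h2 : ∑ z ∈ s, (μ (ball z (2 * r))).toReal ≤ 1 := by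
      rw [← ENNReal.toReal_sum fun _ _ => measure_ne_top _ _]
      exact ENNReal.toReal_le_of_le_ofReal zero_le_one (by simpa using h1)
    have h3 : s.card • (m / 2) ≤ ∑ z ∈ s, (μ (ball z (2 * r))).toReal :=
      Finset.card_nsmul_le_sum _ _ _ fun z hz => (half_mass_lt_measure_ball hm hp (hs.1 z hz)).le
    rw [nsmul_eq_mul] at h3
    linarith
  obtain ⟨N, hN⟩ := exists_nat_gt (2 / m)
  have hbdd : ∀ s, P s → s.card ≤ N := by
    intro s hs
    have := hcard s hs
    rw [← le_div_iff₀ hm0] at this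
    exact_mod_cast this.trans hN.le
  classical
  let n := Nat.findGreatest (fun k => ∃ s, P s ∧ s.card = k) N
  obtain ⟨s, hs, hsn⟩ : ∃ s, P s ∧ s.card = n :=
    Nat.findGreatest_spec (P := fun k => ∃ s, P s ∧ s.card = k) (Nat.zero_le N)
      ⟨∅, ⟨by simp, by simp⟩, rfl⟩
  refine ⟨s, hcard s hs, fun z hz => ?_⟩
  by_contra! hfar
  have hr : 0 < r := (dtm_nonneg hm hp z).trans_lt hz
  have hzs : z ∉ s := fun h => by
    have := hfar z h
    rw [dist_self] at this
    linarith
  have hins : P (insert z s) := by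
    refine ⟨fun w hw => ?_, ?_⟩
    · rcases Finset.mem_insert.1 hw with rfl | hw
      exacts [hz, hs.1 w hw]
    · rw [Finset.coe_insert]
      refine hs.2.insert fun c hc _ => ball_disjoint_ball ?_
      linarith [hfar c hc]
  have hle : (insert z s).card ≤ n :=
    Nat.le_findGreatest (hbdd _ hins) ⟨_, hins, rfl⟩
  rw [Finset.card_insert_of_notMem hzs] at hle
  omega

lemma finite_dtm_eq_zero [IsProbabilityMeasure μ] (hm : m ∈ Ioo (0 : ℝ) 1) (hp : 1 ≤ p) :
    {z : Euc d | dtm m p μ z = 0}.Finite := by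
  by_contra hinf
  obtain ⟨N, hN⟩ := exists_nat_gt (2 / m)
  obtain ⟨t, ht, htN⟩ := Set.Infinite.exists_subset_card_eq hinf (N + 2)
  have hnt : (t : Set (Euc d)).Nontrivial := by
    rw [← Finset.Nontrivial, ← Finset.one_lt_card_iff_nontrivial]
    omega
  have hpos : 0 < (t : Set (Euc d)).infsep := t.finite_toSet.infsep_pos_iff_nontrivial.2 hnt
  obtain ⟨s, hs, hcov⟩ := exists_finset_cover_dtm_lt (μ := μ) (d := d) hm hp
    (r := (t : Set (Euc d)).infsep / 8)
  rw [← le_div_iff₀ hm.1] at hs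
  have hsN : s.card < t.card := by
    have : s.card < N := by exact_mod_cast hs.trans_lt hN
    omega
  choose! f hf hfd using hcov
  have hz : ∀ z ∈ t, dtm m p μ z < (t : Set (Euc d)).infsep / 8 := fun z hzt => by
    rw [show dtm m p μ z = 0 from ht hzt]
    positivity
  obtain ⟨z, hzt, w, hwt, hne, heq⟩ :=
    Finset.exists_ne_map_eq_of_card_lt_of_maps_to hsN fun z hzt => hf z (hz z hzt)
  have h1 := hfd z (hz z hzt)
  have h2 := hfd w (hz w hwt)
  rw [← heq] at h2
  have h3 := Set.infsep_le_dist_of_mem hzt hwt hne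
  linarith [dist_triangle_right z w (f z)]

lemma measure_eq_one_of_measSupport_subset [IsProbabilityMeasure μ] {K : Set (Euc d)}
    (hK : measSupport μ ⊆ K) : μ K = 1 := by
  refine le_antisymm prob_le_one ?_
  have h : μ.support ⊆ K := fun x hx => hK fun r hr =>
    (Measure.mem_support_iff_forall x).1 hx _ (ball_mem_nhds x hr)
  calc (1 : ℝ≥0∞) = μ μ.support := ((prob_compl_eq_zero_iff
        Measure.isClosed_support.measurableSet).1 Measure.measure_compl_support).symm
    _ ≤ μ K := measure_mono h

end DistanceToMeasure

section Paths

variable {d : ℕ} {γ : ℝ → Euc d} {C : ℝ≥0}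

/-- The length measure on `[0, 1]` carried by a path. -/
def lengthMeasure (γ : ℝ → Euc d) : Measure ℝ :=
  (volume.restrict (Icc 0 1)).withDensity fun t => ‖deriv γ t‖ₑ

lemma measurable_enorm_deriv (γ : ℝ → Euc d) : Measurable fun t => ‖deriv γ t‖ₑ :=
  (measurable_deriv γ).enorm

lemma integrableOn_norm_deriv (hγ : LipschitzWith C γ) {s : Set ℝ} (hs : volume s ≠ ∞) :
    IntegrableOn (fun t => ‖deriv γ t‖) s :=
  IntegrableOn.of_bound hs.lt_top (measurable_deriv γ).norm.aestronglyMeasurable (C : ℝ)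
    (Filter.Eventually.of_forall fun t => by
      rw [norm_norm]
      exact norm_deriv_le_of_lipschitz hγ)

lemma lengthMeasure_apply (γ : ℝ → Euc d) {s : Set ℝ} (hs : MeasurableSet s)
    (h : s ⊆ Icc 0 1) : lengthMeasure γ s = ∫⁻ t in s, ‖deriv γ t‖ₑ := by
  rw [lengthMeasure, withDensity_apply _ hs, Measure.restrict_restrict hs, inter_eq_left.2 h]

lemma lengthMeasure_eq_ofReal (hγ : LipschitzWith C γ) {s : Set ℝ} (hs : MeasurableSet s)
    (h : s ⊆ Icc 0 1) : lengthMeasure γ s = ENNReal.ofReal (∫ t in s, ‖deriv γ t‖) := by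
  have hfin : volume s ≠ ∞ := ((measure_mono h).trans_lt (by simp)).ne
  rw [lengthMeasure_apply γ hs h, ofReal_integral_eq_lintegral_ofReal
    (integrableOn_norm_deriv hγ hfin) (Filter.Eventually.of_forall fun t => norm_nonneg _)]
  simp

lemma lengthMeasure_univ (hγ : LipschitzWith C γ) :
    lengthMeasure γ univ = ENNReal.ofReal (eucLength γ) := by
  rw [eucLength, ← lengthMeasure_eq_ofReal hγ measurableSet_Icc subset_rfl, lengthMeasure,
    withDensity_apply _ MeasurableSet.univ, withDensity_apply _ measurableSet_Icc,
    Measure.restrict_univ, Measure.restrict_restrict measurableSet_Icc, inter_self]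

lemma lengthMeasure_absolutelyContinuous (γ : ℝ → Euc d) : lengthMeasure γ ≪ volume :=
  (withDensity_absolutelyContinuous _ _).trans Measure.restrict_le_self.absolutelyContinuous

lemma lengthMeasure_compl_Icc (γ : ℝ → Euc d) : lengthMeasure γ (Icc 0 1)ᶜ = 0 :=
  withDensity_absolutelyContinuous _ _ (by
    rw [Measure.restrict_apply measurableSet_Icc.compl, compl_inter_self, measure_empty])

lemma volume_setOf_eq_and_deriv_ne_zero (γ : ℝ → Euc d) (z : Euc d) :
    volume {t | γ t = z ∧ deriv γ t ≠ 0} = 0 := by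
  refine measure_null_of_locally_null _ fun t ht => ⟨{t}, ?_, by simp⟩
  have hd : HasDerivAt γ (deriv γ t) t := (differentiableAt_of_deriv_ne_zero ht.2).hasDerivAt
  have h := hd.eventually_ne (c := z) ht.2
  rw [eventually_nhdsWithin_iff] at h
  rw [mem_nhdsWithin_iff_eventually]
  filter_upwards [h] with s hs hs'
  by_contra hne
  exact hs hne hs'.1

lemma lengthMeasure_preimage_singleton (hγ : Continuous γ) (z : Euc d) :
    lengthMeasure γ {t | γ t = z} = 0 := by
  have hmeas : MeasurableSet {t | γ t = z} := (isClosed_eq hγ continuous_const).measurableSet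
  rw [lengthMeasure, withDensity_apply _ hmeas, lintegral_eq_zero_iff (measurable_enorm_deriv γ)]
  have h := compl_mem_ae_iff.2 (volume_setOf_eq_and_deriv_ne_zero γ z)
  rw [Filter.EventuallyEq, ae_restrict_iff' hmeas]
  filter_upwards [ae_restrict_of_ae h] with t ht htz
  by_contra hne
  exact ht ⟨htz, by simpa using hne⟩

lemma lengthMeasure_preimage_finite (hγ : Continuous γ) {Z : Set (Euc d)} (hZ : Z.Finite) :
    lengthMeasure γ {t | γ t ∈ Z} = 0 := by
  have : {t | γ t ∈ Z} = ⋃ z ∈ Z, {t | γ t = z} := by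
    ext t
    simp
  rw [this, measure_biUnion_null_iff hZ.countable]
  exact fun z _ => lengthMeasure_preimage_singleton hγ z

lemma integral_inner_deriv (hγ : LipschitzWith C γ) (v : Euc d) (s t : ℝ) :
    ∫ x in s..t, inner ℝ v (deriv γ x) = inner ℝ v (γ t - γ s) := by
  have hlip : LipschitzWith (‖innerSL ℝ v‖₊ * C) fun x => inner ℝ v (γ x) :=
    (innerSL ℝ v).lipschitz.comp hγ
  rw [inner_sub_right, ← hlip.lipschitzOnWith.absolutelyContinuousOnInterval.integral_deriv_eq_sub]
  refine intervalIntegral.integral_congr_ae ?_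
  filter_upwards [hγ.ae_differentiableAt_real] with x hx _
  exact (((innerSL ℝ v).hasFDerivAt.comp_hasDerivAt x hx.hasDerivAt).deriv).symm

lemma sub_eq_integral_smul_of_direction (hγ : LipschitzWith C γ) {a b : ℝ} {u : Euc d}
    (hu : ∀ᵐ t ∂(volume.restrict (Ioo a b)), deriv γ t = ‖deriv γ t‖ • u) {s t : ℝ}
    (has : a ≤ s) (hst : s ≤ t) (htb : t ≤ b) :
    γ t - γ s = (∫ x in s..t, ‖deriv γ x‖) • u := by
  refine ext_inner_left ℝ fun v => ?_
  rw [← integral_inner_deriv hγ, inner_smul_right, ← intervalIntegral.integral_mul_const]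
  refine intervalIntegral.integral_congr_ae ?_
  rw [ae_restrict_iff' measurableSet_Ioo] at hu
  filter_upwards [hu, compl_mem_ae_iff.2 (measure_singleton (b : ℝ))] with x hx hxb hxI
  rw [uIoc_of_le hst] at hxI
  have hxb' : x < b := lt_of_le_of_ne (hxI.2.trans htb) hxb
  exact (congrArg (inner ℝ v) (hx ⟨has.trans_lt hxI.1, hxb'⟩)).trans (inner_smul_right _ _ _)

lemma lengthMeasure_Icc_of_direction (hγ : LipschitzWith C γ) {a b : ℝ} {u : Euc d}
    (ha : 0 ≤ a) (hb : b ≤ 1) (hu1 : ‖u‖ = 1)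
    (hu : ∀ᵐ t ∂(volume.restrict (Ioo a b)), deriv γ t = ‖deriv γ t‖ • u) {s t : ℝ}
    (has : a ≤ s) (hst : s ≤ t) (htb : t ≤ b) :
    lengthMeasure γ (Icc s t) = ENNReal.ofReal (dist (γ s) (γ t)) := by
  rw [lengthMeasure_eq_ofReal hγ measurableSet_Icc (Icc_subset_Icc (ha.trans has) (htb.trans hb)),
    dist_comm, dist_eq_norm, sub_eq_integral_smul_of_direction hγ hu has hst htb, norm_smul, hu1,
    mul_one, integral_Icc_eq_integral_Ioc, ← intervalIntegral.integral_of_le hst,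
    Real.norm_of_nonneg (intervalIntegral.integral_nonneg hst fun _ _ => norm_nonneg _)]

lemma lengthMeasure_le_of_direction (hγ : LipschitzWith C γ) {a b : ℝ} {u : Euc d}
    (ha : 0 ≤ a) (hb : b ≤ 1) (hu1 : ‖u‖ = 1)
    (hu : ∀ᵐ t ∂(volume.restrict (Ioo a b)), deriv γ t = ‖deriv γ t‖ • u) {S : Set ℝ} {L : ℝ}
    (hS : S ⊆ Icc a b) (hL : ∀ s ∈ S, ∀ t ∈ S, dist (γ s) (γ t) ≤ L) :
    lengthMeasure γ S ≤ ENNReal.ofReal L := by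
  rcases S.eq_empty_or_nonempty with rfl | hne
  · simp
  have hbelow : BddBelow S := bddBelow_Icc.mono hS
  have habove : BddAbove S := bddAbove_Icc.mono hS
  have hcl : ∀ s ∈ closure S, ∀ t ∈ closure S, dist (γ s) (γ t) ≤ L := by
    intro s hs t ht
    have hcont : Continuous fun q : ℝ × ℝ => dist (γ q.1) (γ q.2) :=
      (hγ.continuous.comp continuous_fst).dist (hγ.continuous.comp continuous_snd)
    have h := map_mem_closure₂ (f := fun s t => dist (γ s) (γ t)) (u := Iic L) hcont hs ht hL
    rwa [isClosed_Iic.closure_eq] at h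
  calc lengthMeasure γ S ≤ lengthMeasure γ (Icc (sInf S) (sSup S)) :=
        measure_mono fun t ht => ⟨csInf_le hbelow ht, le_csSup habove ht⟩
    _ = ENNReal.ofReal (dist (γ (sInf S)) (γ (sSup S))) :=
        lengthMeasure_Icc_of_direction hγ ha hb hu1 hu (le_csInf hne fun t ht => (hS ht).1)
          (csInf_le_csSup hne hbelow habove) (csSup_le hne fun t ht => (hS ht).2)
    _ ≤ ENNReal.ofReal L := ENNReal.ofReal_le_ofReal
        (hcl _ (csInf_mem_closure hne hbelow) _ (csSup_mem_closure hne habove))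

end Paths

section Splice

variable {d : ℕ} {γ : ℝ → Euc d} {a b : ℝ}

/-- The path `γ` with its piece on `[a, b]` replaced by a straight segment. -/
def splice (γ : ℝ → Euc d) (a b : ℝ) (t : ℝ) : Euc d :=
  γ (min t a) + (max (min t b) a - a) • ((b - a)⁻¹ • (γ b - γ a)) + (γ (max t b) - γ b)

lemma splice_of_le_left (hab : a < b) {t : ℝ} (ht : t ≤ a) : splice γ a b t = γ t := by
  simp [splice, ht, ht.trans hab.le]

lemma splice_of_right_le (hab : a < b) {t : ℝ} (ht : b ≤ t) : splice γ a b t = γ t := by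
  have h : b - a ≠ 0 := (sub_pos.2 hab).ne'
  simp [splice, ht, hab.le, hab.le.trans ht, smul_smul, mul_inv_cancel₀ h]

lemma splice_of_mem_Icc {t : ℝ} (ht : t ∈ Icc a b) :
    splice γ a b t = γ a + (t - a) • ((b - a)⁻¹ • (γ b - γ a)) := by
  simp [splice, ht.1, ht.2]

lemma splice_mem_segment (hab : a < b) {t : ℝ} (ht : t ∈ Icc a b) :
    splice γ a b t ∈ segment ℝ (γ a) (γ b) := by
  rw [segment_eq_image', splice_of_mem_Icc ht]
  have h : 0 < b - a := sub_pos.2 hab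
  refine ⟨(t - a) / (b - a), ⟨div_nonneg (sub_nonneg.2 ht.1) h.le,
    (div_le_one h).2 (by linarith [ht.2])⟩, ?_⟩
  rw [smul_smul, div_eq_mul_inv]

lemma isLipschitzPath_splice (hγ : IsLipschitzPath γ) (a b : ℝ) :
    IsLipschitzPath (splice γ a b) := by
  obtain ⟨C, hC⟩ := hγ
  have h1 := hC.comp (LipschitzWith.id.min_const a)
  have h2 := (ContinuousLinearMap.toSpanSingleton ℝ ((b - a)⁻¹ • (γ b - γ a))).lipschitz.comp
    (((LipschitzWith.id.min_const b).max_const a).sub (LipschitzWith.const a))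
  have h3 := (hC.comp (LipschitzWith.id.max_const b)).sub (LipschitzWith.const (γ b))
  exact ⟨_, (h1.add h2).add h3⟩

lemma deriv_splice_of_lt_left (hab : a < b) {t : ℝ} (ht : t < a) :
    deriv (splice γ a b) t = deriv γ t :=
  Filter.EventuallyEq.deriv_eq ((gt_mem_nhds ht).mono fun _ hs => splice_of_le_left hab hs.le)

lemma deriv_splice_of_right_lt (hab : a < b) {t : ℝ} (ht : b < t) :
    deriv (splice γ a b) t = deriv γ t :=
  Filter.EventuallyEq.deriv_eq ((lt_mem_nhds ht).mono fun _ hs => splice_of_right_le hab hs.le)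

lemma deriv_splice_of_mem_Ioo {t : ℝ} (ht : t ∈ Ioo a b) :
    deriv (splice γ a b) t = (b - a)⁻¹ • (γ b - γ a) := by
  have h : splice γ a b =ᶠ[nhds t] fun s => γ a + (s - a) • ((b - a)⁻¹ • (γ b - γ a)) :=
    Filter.mem_of_superset (isOpen_Ioo.mem_nhds ht) fun _ hs =>
      splice_of_mem_Icc (Ioo_subset_Icc_self hs)
  rw [h.deriv_eq]
  have := (((hasDerivAt_id t).sub_const a).smul_const ((b - a)⁻¹ • (γ b - γ a))).const_add (γ a)
  simpa using this.deriv

lemma admissiblePath_splice {F : Set (Euc d)} {x y : Euc d} (hγ : AdmissiblePath F x y γ)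
    (hab : a < b) (ha : 0 ≤ a) (hb : b ≤ 1) (haF : γ a ∈ F ∨ a = 0) (hbF : γ b ∈ F ∨ b = 1) :
    AdmissiblePath F x y (splice γ a b) := by
  obtain ⟨hlip, h0, h1, hdir⟩ := hγ
  refine ⟨isLipschitzPath_splice hlip a b, ?_, ?_, fun s t hs ht hst => ?_⟩
  · rw [splice_of_le_left hab ha, h0]
  · rw [splice_of_right_le hab hb, h1]
  have haI : a ∉ Ioo s t := fun h => by
    rcases haF with haF | rfl
    · exact hst a h (by rwa [splice_of_le_left hab le_rfl])
    · exact absurd h.1 (not_lt.2 hs)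
  have hbI : b ∉ Ioo s t := fun h => by
    rcases hbF with hbF | rfl
    · exact hst b h (by rwa [splice_of_right_le hab le_rfl])
    · exact absurd h.2 (not_lt.2 ht)
  have hkeep : (∀ r ∈ Ioo s t, r < a) ∨ (∀ r ∈ Ioo s t, b < r) →
      ∃ u : Euc d, ‖u‖ = 1 ∧ ∀ᵐ r ∂(volume.restrict (Ioo s t)),
        deriv (splice γ a b) r = ‖deriv (splice γ a b) r‖ • u := by
    intro h
    have heq : ∀ r ∈ Ioo s t, splice γ a b r = γ r ∧ deriv (splice γ a b) r = deriv γ r := by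
      intro r hr
      rcases h with h | h
      · exact ⟨splice_of_le_left hab (h r hr).le, deriv_splice_of_lt_left hab (h r hr)⟩
      · exact ⟨splice_of_right_le hab (h r hr).le, deriv_splice_of_right_lt hab (h r hr)⟩
    obtain ⟨u, hu, hdu⟩ := hdir s t hs ht fun r hr => by
      rw [← (heq r hr).1]
      exact hst r hr
    refine ⟨u, hu, ?_⟩
    filter_upwards [hdu, ae_restrict_mem measurableSet_Ioo] with r hr hrI
    rwa [(heq r hrI).2]
  rcases le_or_gt t a with hta | hta
  · exact hkeep (Or.inl fun r hr => hr.2.trans_le hta)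
  rcases le_or_gt b s with hbs | hbs
  · exact hkeep (Or.inr fun r hr => hbs.trans_lt hr.1)
  have hsub : Ioo s t ⊆ Ioo a b := by
    refine Ioo_subset_Ioo ?_ ?_
    · by_contra! h
      exact haI ⟨h, hta⟩
    · by_contra! h
      exact hbI ⟨hbs, h⟩
  obtain ⟨e, he, -⟩ := hdir 0 0 le_rfl zero_le_one (by simp)
  set v := (b - a)⁻¹ • (γ b - γ a) with hv
  have hderiv : ∀ᵐ r ∂(volume.restrict (Ioo s t)), deriv (splice γ a b) r = v := by
    filter_upwards [ae_restrict_mem measurableSet_Ioo] with r hr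
    exact deriv_splice_of_mem_Ioo (hsub hr)
  rcases eq_or_ne v 0 with h0v | h0v
  · refine ⟨e, he, hderiv.mono fun r hr => ?_⟩
    rw [hr, h0v, norm_zero, zero_smul]
  · refine ⟨‖v‖⁻¹ • v, norm_smul_inv_norm h0v, hderiv.mono fun r hr => ?_⟩
    rw [hr, smul_smul, mul_inv_cancel₀ (norm_ne_zero_iff.2 h0v), one_smul]

lemma intervalIntegrable_dtm_rpow_mul {m p β : ℝ} {μ : Measure (Euc d)} [IsProbabilityMeasure μ]
    (hm : m ∈ Ioo (0 : ℝ) 1) (hp : 1 ≤ p) (hβ : 0 ≤ β) (hγ : IsLipschitzPath γ) (s t : ℝ) :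
    IntervalIntegrable (fun r => dtm m p μ (γ r) ^ β * ‖deriv γ r‖) volume s t := by
  obtain ⟨C, hC⟩ := hγ
  have h : IntervalIntegrable (fun r => ‖deriv γ r‖) volume s t :=
    ⟨integrableOn_norm_deriv hC (by simp), integrableOn_norm_deriv hC (by simp)⟩
  exact h.continuousOn_mul ((((lipschitzWith_dtm hm hp).continuous.comp hC.continuous).rpow_const
    fun _ => Or.inr hβ).continuousOn)

lemma fdtmLength_eq_add {m p β : ℝ} {μ : Measure (Euc d)} [IsProbabilityMeasure μ]
    (hm : m ∈ Ioo (0 : ℝ) 1) (hp : 1 ≤ p) (hβ : 0 ≤ β) (hγ : IsLipschitzPath γ) (a b : ℝ) :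
    fdtmLength m p β μ γ = (∫ r in (0 : ℝ)..a, dtm m p μ (γ r) ^ β * ‖deriv γ r‖) +
      (∫ r in a..b, dtm m p μ (γ r) ^ β * ‖deriv γ r‖) +
      ∫ r in b..1, dtm m p μ (γ r) ^ β * ‖deriv γ r‖ := by
  have hint := intervalIntegrable_dtm_rpow_mul (μ := μ) hm hp hβ hγ
  rw [intervalIntegral.integral_add_adjacent_intervals (hint 0 a) (hint a b),
    intervalIntegral.integral_add_adjacent_intervals (hint 0 b) (hint b 1), fdtmLength,
    integral_Icc_eq_integral_Ioc, intervalIntegral.integral_of_le zero_le_one]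

/-- A piece of a geodesic between two times at which it may be cut has FDTM length at most that of
the straight segment between its endpoints. -/
lemma integral_geodesic_piece_le {m p β : ℝ} {μ : Measure (Euc d)} [IsProbabilityMeasure μ]
    (hm : m ∈ Ioo (0 : ℝ) 1) (hp : 1 ≤ p) (hβ : 0 ≤ β) {F : Set (Euc d)} {x y : Euc d}
    (hγ : IsGeodesic m p β μ F x y γ)
    (hab : a < b) (ha : 0 ≤ a) (hb : b ≤ 1) (haF : γ a ∈ F ∨ a = 0) (hbF : γ b ∈ F ∨ b = 1)
    {M : ℝ} (hM : ∀ z ∈ segment ℝ (γ a) (γ b), dtm m p μ z ≤ M) :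
    ∫ r in a..b, dtm m p μ (γ r) ^ β * ‖deriv γ r‖ ≤ M ^ β * dist (γ a) (γ b) := by
  have hadm := admissiblePath_splice hγ.1 hab ha hb haF hbF
  have hle : fdtmLength m p β μ γ ≤ fdtmLength m p β μ (splice γ a b) := by
    rw [hγ.2]
    refine csInf_le ⟨0, ?_⟩ ⟨_, hadm, rfl⟩
    rintro _ ⟨σ, -, rfl⟩
    exact integral_nonneg fun t =>
      mul_nonneg (Real.rpow_nonneg (dtm_nonneg hm hp _) _) (norm_nonneg _)
  rw [fdtmLength_eq_add hm hp hβ hγ.1.1 a b, fdtmLength_eq_add hm hp hβ hadm.1 a b] at hle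
  have hne : ∀ c : ℝ, ∀ᵐ r : ℝ, r ≠ c := fun c => compl_mem_ae_iff.2 (measure_singleton c)
  have h1 : ∫ r in (0 : ℝ)..a, dtm m p μ (splice γ a b r) ^ β * ‖deriv (splice γ a b) r‖ =
      ∫ r in (0 : ℝ)..a, dtm m p μ (γ r) ^ β * ‖deriv γ r‖ := by
    refine intervalIntegral.integral_congr_ae ?_
    filter_upwards [hne a] with r hr hrI
    rw [uIoc_of_le ha] at hrI
    rw [splice_of_le_left hab hrI.2, deriv_splice_of_lt_left hab (lt_of_le_of_ne hrI.2 hr)]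
  have h3 : ∫ r in b..1, dtm m p μ (splice γ a b r) ^ β * ‖deriv (splice γ a b) r‖ =
      ∫ r in b..1, dtm m p μ (γ r) ^ β * ‖deriv γ r‖ := by
    refine intervalIntegral.integral_congr_ae (Filter.Eventually.of_forall fun r hrI => ?_)
    rw [uIoc_of_le hb] at hrI
    rw [splice_of_right_le hab hrI.1.le, deriv_splice_of_right_lt hab hrI.1]
  have h2 : ∫ r in a..b, dtm m p μ (splice γ a b r) ^ β * ‖deriv (splice γ a b) r‖ ≤
      M ^ β * dist (γ a) (γ b) := by
    have hpos : 0 < b - a := sub_pos.2 hab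
    calc _ ≤ ∫ _ in a..b, M ^ β * ((b - a)⁻¹ * dist (γ a) (γ b)) := by
          refine intervalIntegral.integral_mono_on_of_le_Ioo hab.le
            (intervalIntegrable_dtm_rpow_mul hm hp hβ hadm.1 a b) (by simp) fun r hr => ?_
          have hz := hM _ (splice_mem_segment hab (Ioo_subset_Icc_self hr))
          rw [deriv_splice_of_mem_Ioo hr, norm_smul, Real.norm_of_nonneg (inv_nonneg.2 hpos.le),
            ← dist_eq_norm, dist_comm (γ b)]
          have := dtm_nonneg (μ := μ) hm hp (splice γ a b r)
          gcongr
      _ = M ^ β * dist (γ a) (γ b) := by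
          rw [intervalIntegral.integral_const, smul_eq_mul]
          field_simp
  rw [h1, h3] at hle
  linarith

end Splice

section CutTimes

variable {d : ℕ} {γ : ℝ → Euc d} {F : Set (Euc d)} {x y : Euc d} {t s : ℝ}

/-- The times at which an admissible path may be cut: those spent in the domain, and the two
endpoints. -/
def cutTimes (F : Set (Euc d)) (γ : ℝ → Euc d) : Set ℝ :=
  {t | t ∈ Icc (0 : ℝ) 1 ∧ (γ t ∈ F ∨ t = 0 ∨ t = 1)}

/-- The last cut time before `t`. -/
def prevCut (F : Set (Euc d)) (γ : ℝ → Euc d) (t : ℝ) : ℝ := sSup (cutTimes F γ ∩ Iic t)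

/-- The first cut time after `t`. -/
def nextCut (F : Set (Euc d)) (γ : ℝ → Euc d) (t : ℝ) : ℝ := sInf (cutTimes F γ ∩ Ici t)

/-- The distance between the positions at the cut times surrounding `t`. -/
def jump (F : Set (Euc d)) (γ : ℝ → Euc d) (t : ℝ) : ℝ :=
  dist (γ (prevCut F γ t)) (γ (nextCut F γ t))

lemma isClosed_cutTimes (hF : IsClosed F) (hγ : Continuous γ) : IsClosed (cutTimes F γ) :=
  isClosed_Icc.inter ((hF.preimage hγ).union (isClosed_singleton.union isClosed_singleton))

lemma prevCut_mem (hF : IsClosed F) (hγ : Continuous γ) (ht : t ∈ Icc (0 : ℝ) 1) :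
    prevCut F γ t ∈ cutTimes F γ ∩ Iic t :=
  ((isClosed_cutTimes hF hγ).inter isClosed_Iic).csSup_mem
    ⟨0, ⟨⟨le_rfl, zero_le_one⟩, Or.inr (Or.inl rfl)⟩, ht.1⟩ ⟨t, fun _ hs => hs.2⟩

lemma nextCut_mem (hF : IsClosed F) (hγ : Continuous γ) (ht : t ∈ Icc (0 : ℝ) 1) :
    nextCut F γ t ∈ cutTimes F γ ∩ Ici t :=
  ((isClosed_cutTimes hF hγ).inter isClosed_Ici).csInf_mem
    ⟨1, ⟨⟨zero_le_one, le_rfl⟩, Or.inr (Or.inr rfl)⟩, ht.2⟩ ⟨t, fun _ hs => hs.2⟩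

lemma le_prevCut (hs : s ∈ cutTimes F γ) (hst : s ≤ t) : s ≤ prevCut F γ t :=
  le_csSup ⟨t, fun _ hr => hr.2⟩ ⟨hs, hst⟩

lemma nextCut_le (hs : s ∈ cutTimes F γ) (hst : t ≤ s) : nextCut F γ t ≤ s :=
  csInf_le ⟨t, fun _ hr => hr.2⟩ ⟨hs, hst⟩

lemma notMem_cutTimes_of_mem_Ioo (hs : s ∈ Ioo (prevCut F γ t) (nextCut F γ t)) :
    s ∉ cutTimes F γ := fun h => by
  rcases le_total s t with hst | hst
  · exact absurd hs.1 (not_lt.2 (le_prevCut h hst))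
  · exact absurd hs.2 (not_lt.2 (nextCut_le h hst))

lemma Icc_prevCut_nextCut_subset (hF : IsClosed F) (hγ : Continuous γ) (ht : t ∈ Icc (0 : ℝ) 1) :
    Icc (prevCut F γ t) (nextCut F γ t) ⊆ Icc 0 1 :=
  Icc_subset_Icc (prevCut_mem hF hγ ht).1.1.1 (nextCut_mem hF hγ ht).1.1.2

lemma prevCut_eq_of_mem_Ioo (hF : IsClosed F) (hγ : Continuous γ) (ht : t ∈ Icc (0 : ℝ) 1)
    (hs : s ∈ Ioo (prevCut F γ t) (nextCut F γ t)) : prevCut F γ s = prevCut F γ t := by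
  have hsI := Icc_prevCut_nextCut_subset hF hγ ht (Ioo_subset_Icc_self hs)
  have h := prevCut_mem hF hγ hsI
  refine le_antisymm ?_ (le_prevCut (prevCut_mem hF hγ ht).1 hs.1.le)
  by_contra! hlt
  exact notMem_cutTimes_of_mem_Ioo ⟨hlt, h.2.trans_lt hs.2⟩ h.1

lemma nextCut_eq_of_mem_Ioo (hF : IsClosed F) (hγ : Continuous γ) (ht : t ∈ Icc (0 : ℝ) 1)
    (hs : s ∈ Ioo (prevCut F γ t) (nextCut F γ t)) : nextCut F γ s = nextCut F γ t := by
  have hsI := Icc_prevCut_nextCut_subset hF hγ ht (Ioo_subset_Icc_self hs)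
  have h := nextCut_mem hF hγ hsI
  refine le_antisymm (nextCut_le (nextCut_mem hF hγ ht).1 hs.2.le) ?_
  by_contra! hlt
  exact notMem_cutTimes_of_mem_Ioo ⟨hs.1.trans_le h.2, hlt⟩ h.1

lemma mem_Ioo_prevCut_nextCut (hF : IsClosed F) (hγ : Continuous γ) (ht : t ∈ Icc (0 : ℝ) 1)
    (hcut : t ∉ cutTimes F γ) : t ∈ Ioo (prevCut F γ t) (nextCut F γ t) := by
  have hp := prevCut_mem hF hγ ht
  have hn := nextCut_mem hF hγ ht
  refine ⟨lt_of_le_of_ne hp.2 fun h => hcut ?_, lt_of_le_of_ne hn.2 fun h => hcut ?_⟩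
  · rw [← h]
    exact hp.1
  · rw [h]
    exact hn.1

lemma jump_eq_zero_of_mem_cutTimes (ht : t ∈ cutTimes F γ) : jump F γ t = 0 := by
  have h1 : prevCut F γ t = t :=
    le_antisymm (csSup_le ⟨t, ht, self_mem_Iic⟩ fun _ hs => hs.2) (le_prevCut ht le_rfl)
  have h2 : nextCut F γ t = t :=
    le_antisymm (nextCut_le ht le_rfl) (le_csInf ⟨t, ht, self_mem_Ici⟩ fun _ hs => hs.2)
  rw [jump, h1, h2, dist_self]

lemma AdmissiblePath.exists_direction (hadm : AdmissiblePath F x y γ) (hF : IsClosed F)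
    (ht : t ∈ Icc (0 : ℝ) 1) : ∃ u : Euc d, ‖u‖ = 1 ∧
      ∀ᵐ s ∂(volume.restrict (Ioo (prevCut F γ t) (nextCut F γ t))),
        deriv γ s = ‖deriv γ s‖ • u := by
  obtain ⟨⟨C, hC⟩, -, -, hdir⟩ := hadm
  have hp := prevCut_mem hF hC.continuous ht
  have hn := nextCut_mem hF hC.continuous ht
  refine hdir _ _ hp.1.1.1 hn.1.1.2 fun s hs hsF => notMem_cutTimes_of_mem_Ioo hs ⟨?_, Or.inl hsF⟩
  exact Icc_prevCut_nextCut_subset hF hC.continuous ht (Ioo_subset_Icc_self hs)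

lemma AdmissiblePath.mem_segment (hadm : AdmissiblePath F x y γ) (hF : IsClosed F)
    (ht : t ∈ Icc (0 : ℝ) 1) :
    γ t ∈ segment ℝ (γ (prevCut F γ t)) (γ (nextCut F γ t)) := by
  obtain ⟨u, -, hdu⟩ := hadm.exists_direction hF ht
  obtain ⟨⟨C, hC⟩, -, -, -⟩ := hadm
  have hp := (prevCut_mem hF hC.continuous ht).2
  have hn := (nextCut_mem hF hC.continuous ht).2
  set a := prevCut F γ t
  set b := nextCut F γ t
  have h1 := sub_eq_integral_smul_of_direction hC hdu le_rfl hp hn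
  have h2 := sub_eq_integral_smul_of_direction hC hdu hp hn le_rfl
  set p := ∫ r in a..t, ‖deriv γ r‖
  set q := ∫ r in t..b, ‖deriv γ r‖
  have hp0 : 0 ≤ p := intervalIntegral.integral_nonneg hp fun _ _ => norm_nonneg _
  have hq0 : 0 ≤ q := intervalIntegral.integral_nonneg hn fun _ _ => norm_nonneg _
  rw [mem_segment_iff_sameRay, h1, h2]
  exact (SameRay.sameRay_nonneg_smul_left u hp0).trans
    (SameRay.sameRay_nonneg_smul_right u hq0) (by
      intro h
      simp [h])

lemma AdmissiblePath.mem_convex (hadm : AdmissiblePath F x y γ) (hF : IsClosed F)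
    {K : Set (Euc d)} (hK : Convex ℝ K) (hFK : F ⊆ K) (hx : x ∈ K) (hy : y ∈ K)
    (ht : t ∈ Icc (0 : ℝ) 1) : γ t ∈ K := by
  have hcut : ∀ s ∈ cutTimes F γ, γ s ∈ K := by
    rintro s ⟨-, hs | rfl | rfl⟩
    · exact hFK hs
    · rwa [hadm.2.1]
    · rwa [hadm.2.2.1]
  have hcont : Continuous γ := hadm.1.choose_spec.continuous
  exact hK.segment_subset (hcut _ (prevCut_mem hF hcont ht).1) (hcut _ (nextCut_mem hF hcont ht).1)
    (hadm.mem_segment hF ht)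

lemma AdmissiblePath.dist_prevCut_le (hadm : AdmissiblePath F x y γ) (hF : IsClosed F)
    (ht : t ∈ Icc (0 : ℝ) 1) : dist (γ (prevCut F γ t)) (γ t) ≤ jump F γ t := by
  have := dist_add_dist_of_mem_segment (hadm.mem_segment hF ht)
  rw [jump]
  linarith [dist_nonneg (x := γ t) (y := γ (nextCut F γ t))]

lemma AdmissiblePath.dist_nextCut_le (hadm : AdmissiblePath F x y γ) (hF : IsClosed F)
    (ht : t ∈ Icc (0 : ℝ) 1) : dist (γ (nextCut F γ t)) (γ t) ≤ jump F γ t := by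
  have := dist_add_dist_of_mem_segment (hadm.mem_segment hF ht)
  rw [jump, dist_comm]
  linarith [dist_nonneg (x := γ (prevCut F γ t)) (y := γ t)]

end CutTimes

section LongJumps

variable {d : ℕ} {m p : ℝ} {μ : Measure (Euc d)} {γ : ℝ → Euc d} {F : Set (Euc d)} {x y : Euc d}

/-- The times spent on a segment that is long compared with the distance-to-measure. -/
def longJumpTimes (m p : ℝ) (μ : Measure (Euc d)) (F : Set (Euc d)) (γ : ℝ → Euc d) : Set ℝ :=
  {t | t ∈ Icc (0 : ℝ) 1 ∧ dtm m p μ (γ t) < m / 32 * jump F γ t}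

lemma two_mul_lengthMeasure_longJumpTimes_inter_le [IsProbabilityMeasure μ]
    (hm : m ∈ Ioo (0 : ℝ) 1) (hp : 1 ≤ p) (hadm : AdmissiblePath F x y γ) (hF : IsClosed F)
    {t : ℝ} (ht : t ∈ Icc (0 : ℝ) 1) :
    2 * lengthMeasure γ (longJumpTimes m p μ F γ ∩ Ioo (prevCut F γ t) (nextCut F γ t)) ≤
      lengthMeasure γ (Ioo (prevCut F γ t) (nextCut F γ t)) := by
  obtain ⟨u, hu, hdu⟩ := hadm.exists_direction hF ht
  obtain ⟨C, hC⟩ := hadm.1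
  have hpc := prevCut_mem hF hC.continuous ht
  have hnc := nextCut_mem hF hC.continuous ht
  have hjump : ∀ s ∈ Ioo (prevCut F γ t) (nextCut F γ t), jump F γ s = jump F γ t :=
    fun s hs => by rw [jump, prevCut_eq_of_mem_Ioo hF hC.continuous ht hs,
      nextCut_eq_of_mem_Ioo hF hC.continuous ht hs, ← jump]
  set a := prevCut F γ t
  set b := nextCut F γ t
  set ℓ := jump F γ t with hℓ
  have hℓ0 : 0 ≤ ℓ := dist_nonneg
  obtain ⟨S, hS, hcov⟩ := exists_finset_cover_dtm_lt (μ := μ) (d := d) hm hp (r := m / 32 * ℓ)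
  have hsub : longJumpTimes m p μ F γ ∩ Ioo a b ⊆
      ⋃ c ∈ S, {s | s ∈ Icc a b ∧ dist (γ s) c < 4 * (m / 32 * ℓ)} := by
    rintro s ⟨hs, hsI⟩
    have h := hs.2
    rw [hjump s hsI] at h
    obtain ⟨c, hc, hsc⟩ := hcov _ h
    exact mem_iUnion₂.2 ⟨c, hc, Ioo_subset_Icc_self hsI, hsc⟩
  have hpiece : ∀ c ∈ S, lengthMeasure γ {s | s ∈ Icc a b ∧ dist (γ s) c < 4 * (m / 32 * ℓ)} ≤
      ENNReal.ofReal (m / 4 * ℓ) := fun c _ =>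
    lengthMeasure_le_of_direction hC hpc.1.1.1 hnc.1.1.2 hu hdu (fun s hs => hs.1)
      fun s hs r hr => by linarith [dist_triangle_right (γ s) (γ r) c, hs.2, hr.2]
  have htotal : lengthMeasure γ (Ioo a b) = ENNReal.ofReal ℓ := by
    rw [measure_congr ((lengthMeasure_absolutelyContinuous γ).ae_le Ioo_ae_eq_Icc),
      lengthMeasure_Icc_of_direction hC hpc.1.1.1 hnc.1.1.2 hu hdu le_rfl (hpc.2.trans hnc.2)
        le_rfl]
    rfl
  calc 2 * lengthMeasure γ (longJumpTimes m p μ F γ ∩ Ioo a b)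
      ≤ 2 * ∑ _c ∈ S, ENNReal.ofReal (m / 4 * ℓ) := by
        gcongr
        exact (measure_mono hsub).trans ((measure_biUnion_finset_le _ _).trans
          (Finset.sum_le_sum hpiece))
    _ = ENNReal.ofReal (2 * (S.card * (m / 4 * ℓ))) := by
        rw [Finset.sum_const, nsmul_eq_mul, ENNReal.ofReal_mul two_pos.le,
          ENNReal.ofReal_mul (Nat.cast_nonneg _), ENNReal.ofReal_natCast, ENNReal.ofReal_ofNat]
    _ ≤ ENNReal.ofReal ℓ := ENNReal.ofReal_le_ofReal (by nlinarith)
    _ = lengthMeasure γ (Ioo a b) := htotal.symm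

/-- At most half of the length is spent on long jumps. -/
lemma two_mul_lengthMeasure_longJumpTimes_le [IsProbabilityMeasure μ]
    (hm : m ∈ Ioo (0 : ℝ) 1) (hp : 1 ≤ p) (hadm : AdmissiblePath F x y γ) (hF : IsClosed F) :
    2 * lengthMeasure γ (longJumpTimes m p μ F γ) ≤ lengthMeasure γ univ := by
  have hcont : Continuous γ := hadm.1.choose_spec.continuous
  let I : ℝ → Set ℝ := fun t => Ioo (prevCut F γ t) (nextCut F γ t)
  let T : Set ℝ := Icc 0 1 \ cutTimes F γ
  have hdisj : (I '' T).PairwiseDisjoint id := by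
    rintro _ ⟨s, hs, rfl⟩ _ ⟨t, ht, rfl⟩ hne
    refine Set.disjoint_left.2 fun r hrs hrt => hne ?_
    simp only [I]
    rw [← prevCut_eq_of_mem_Ioo hF hcont hs.1 hrs, ← nextCut_eq_of_mem_Ioo hF hcont hs.1 hrs,
      prevCut_eq_of_mem_Ioo hF hcont ht.1 hrt, nextCut_eq_of_mem_Ioo hF hcont ht.1 hrt]
  have hcount : (I '' T).Countable := by
    refine hdisj.countable_of_isOpen ?_ ?_
    · rintro _ ⟨t, -, rfl⟩
      exact isOpen_Ioo
    · rintro _ ⟨t, ht, rfl⟩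
      exact ⟨t, mem_Ioo_prevCut_nextCut hF hcont ht.1 ht.2⟩
  have hcover : longJumpTimes m p μ F γ ⊆ ⋃ J ∈ I '' T, longJumpTimes m p μ F γ ∩ J := by
    intro t ht
    have hcut : t ∉ cutTimes F γ := fun h => by
      have h' := ht.2
      rw [jump_eq_zero_of_mem_cutTimes h, mul_zero] at h'
      exact absurd h' (not_lt.2 (dtm_nonneg hm hp _))
    exact mem_iUnion₂.2 ⟨I t, mem_image_of_mem I ⟨ht.1, hcut⟩, ht,
      mem_Ioo_prevCut_nextCut hF hcont ht.1 hcut⟩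
  have := hcount.to_subtype
  calc 2 * lengthMeasure γ (longJumpTimes m p μ F γ)
      ≤ 2 * ∑' J : I '' T, lengthMeasure γ (longJumpTimes m p μ F γ ∩ J) := by
        gcongr
        exact (measure_mono hcover).trans (measure_biUnion_le _ hcount _)
    _ = ∑' J : I '' T, 2 * lengthMeasure γ (longJumpTimes m p μ F γ ∩ J) :=
        ENNReal.tsum_mul_left.symm
    _ ≤ ∑' J : I '' T, lengthMeasure γ J := by
        refine ENNReal.tsum_le_tsum ?_
        rintro ⟨_, t, ht, rfl⟩
        exact two_mul_lengthMeasure_longJumpTimes_inter_le hm hp hadm hF ht.1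
    _ = lengthMeasure γ (⋃ J ∈ I '' T, J) := by
        refine (measure_biUnion hcount hdisj ?_).symm
        rintro _ ⟨t, -, rfl⟩
        exact measurableSet_Ioo
    _ ≤ lengthMeasure γ univ := measure_mono (subset_univ _)

end LongJumps

section Scales

variable {d : ℕ} {m p β : ℝ} {μ : Measure (Euc d)} {γ : ℝ → Euc d} {F : Set (Euc d)} {x y : Euc d}

lemma lengthMeasure_setOf_le_dtm_le [IsProbabilityMeasure μ] (hm : m ∈ Ioo (0 : ℝ) 1)
    (hp : 1 ≤ p) (hβ : 0 ≤ β) (hγ : IsLipschitzPath γ) {a b s : ℝ} (ha : 0 ≤ a) (hab : a ≤ b)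
    (hb : b ≤ 1) (hs : 0 < s) :
    lengthMeasure γ {t | t ∈ Icc a b ∧ s ≤ dtm m p μ (γ t)} ≤
      ENNReal.ofReal ((∫ r in a..b, dtm m p μ (γ r) ^ β * ‖deriv γ r‖) / s ^ β) := by
  have hint := intervalIntegrable_dtm_rpow_mul (μ := μ) hm hp hβ hγ a b
  obtain ⟨C, hC⟩ := hγ
  set A := {t | t ∈ Icc a b ∧ s ≤ dtm m p μ (γ t)} with hA
  have hAm : MeasurableSet A := (isClosed_Icc.inter (isClosed_le continuous_const
    ((lipschitzWith_dtm hm hp).continuous.comp hC.continuous))).measurableSet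
  have hAsub : A ⊆ Icc a b := fun t ht => ht.1
  have hnonneg : ∀ r, 0 ≤ dtm m p μ (γ r) ^ β * ‖deriv γ r‖ := fun r =>
    mul_nonneg (Real.rpow_nonneg (dtm_nonneg hm hp _) _) (norm_nonneg _)
  rw [intervalIntegrable_iff_integrableOn_Icc_of_le hab] at hint
  rw [lengthMeasure_eq_ofReal hC hAm (hAsub.trans (Icc_subset_Icc ha hb))]
  refine ENNReal.ofReal_le_ofReal ?_
  have hsβ : 0 < s ^ β := Real.rpow_pos_of_pos hs β
  rw [le_div_iff₀ hsβ, ← integral_mul_const, intervalIntegral.integral_of_le hab,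
    ← integral_Icc_eq_integral_Ioc]
  calc ∫ t in A, ‖deriv γ t‖ * s ^ β
      ≤ ∫ t in A, dtm m p μ (γ t) ^ β * ‖deriv γ t‖ := by
        refine setIntegral_mono_on ?_ (hint.mono_set hAsub) hAm fun t ht => ?_
        · exact (integrableOn_norm_deriv hC
            ((measure_mono hAsub).trans_lt (by simp)).ne).mul_const _
        · rw [mul_comm]
          have := ht.2
          gcongr
    _ ≤ ∫ t in Icc a b, dtm m p μ (γ t) ^ β * ‖deriv γ t‖ :=
        setIntegral_mono_set hint (Filter.Eventually.of_forall hnonneg) hAsub.eventuallyLE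

/-- The times outside of the long jumps at which the distance-to-measure lies in `[s, r]`. -/
def scaleTimes (m p : ℝ) (μ : Measure (Euc d)) (F : Set (Euc d)) (γ : ℝ → Euc d) (s r : ℝ) :
    Set ℝ :=
  {t | t ∈ Icc (0 : ℝ) 1 ∧ t ∉ longJumpTimes m p μ F γ ∧ s ≤ dtm m p μ (γ t) ∧ dtm m p μ (γ t) ≤ r}

lemma lengthMeasure_scaleTimes_inter_le [IsProbabilityMeasure μ] (hm : m ∈ Ioo (0 : ℝ) 1)
    (hp : 1 ≤ p) (hβ : 0 ≤ β) (hγ : IsGeodesic m p β μ F x y γ) (hF : IsClosed F) {s r : ℝ}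
    (hs : 0 < s) (hr : 0 < r) (c : Euc d) :
    lengthMeasure γ (scaleTimes m p μ F γ s r ∩ {t | dist (γ t) c < 8 * r}) ≤
      ENNReal.ofReal ((49 * r / m) ^ β * (80 * r / m) / s ^ β) := by
  have hm0 := hm.1
  have hadm := hγ.1
  have hcont : Continuous γ := hadm.1.choose_spec.continuous
  have hrm : r ≤ r / m := le_div_self hr.le hm0 hm.2.le
  set T := scaleTimes m p μ F γ s r ∩ {t | dist (γ t) c < 8 * r} with hT
  rcases T.eq_empty_or_nonempty with hemp | ⟨t₀, ht₀⟩
  · rw [hemp, measure_empty]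
    exact zero_le
  let Q : Set ℝ := cutTimes F γ ∩ γ ⁻¹' closedBall c (40 * (r / m))
  have hQ : IsCompact Q := isCompact_Icc.of_isClosed_subset
    ((isClosed_cutTimes hF hcont).inter (isClosed_closedBall.preimage hcont)) fun t ht => ht.1.1
  have hjump : ∀ t ∈ T, jump F γ t ≤ 32 * (r / m) := by
    intro t ht
    have h1 : m / 32 * jump F γ t ≤ r :=
      (not_lt.1 fun h => ht.1.2.1 ⟨ht.1.1, h⟩).trans ht.1.2.2.2
    rw [← mul_div_assoc, le_div_iff₀ hm0]
    linarith
  have hprev : ∀ t ∈ T, prevCut F γ t ∈ Q ∩ Iic t := by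
    intro t ht
    have h := prevCut_mem hF hcont ht.1.1
    refine ⟨⟨h.1, mem_closedBall.2 ?_⟩, h.2⟩
    have h1 := hadm.dist_prevCut_le hF ht.1.1
    have h2 : dist (γ t) c < 8 * r := ht.2
    linarith [dist_triangle (γ (prevCut F γ t)) (γ t) c, hjump t ht]
  have hnext : ∀ t ∈ T, nextCut F γ t ∈ Q ∩ Ici t := by
    intro t ht
    have h := nextCut_mem hF hcont ht.1.1
    refine ⟨⟨h.1, mem_closedBall.2 ?_⟩, h.2⟩
    have h1 := hadm.dist_nextCut_le hF ht.1.1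
    have h2 : dist (γ t) c < 8 * r := ht.2
    linarith [dist_triangle (γ (nextCut F γ t)) (γ t) c, hjump t ht]
  have hne : Q.Nonempty := ⟨_, (hprev t₀ ht₀).1⟩
  obtain ⟨a, ha, ha'⟩ := hQ.exists_isLeast hne
  obtain ⟨b, hb, hb'⟩ := hQ.exists_isGreatest hne
  have hTsub : T ⊆ {t | t ∈ Icc a b ∧ s ≤ dtm m p μ (γ t)} := fun t ht =>
    ⟨⟨(ha' (hprev t ht).1).trans (hprev t ht).2, (hnext t ht).2.trans (hb' (hnext t ht).1)⟩,
      ht.1.2.2.1⟩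
  rcases (ha' hb).eq_or_lt with hab | hab
  · refine (measure_mono (hTsub.trans fun t ht => ht.1)).trans ?_
    rw [hab, Icc_self, lengthMeasure_absolutelyContinuous γ Real.volume_singleton]
    exact zero_le
  have hc : dtm m p μ c ≤ 9 * (r / m) := by
    have h2 : dist (γ t₀) c < 8 * r := ht₀.2
    have := dtm_le_add_dist (μ := μ) hm hp c (γ t₀)
    rw [dist_comm] at this
    linarith [ht₀.1.2.2.2]
  have hM : ∀ z ∈ segment ℝ (γ a) (γ b), dtm m p μ z ≤ 49 * r / m := by
    intro z hz
    have h := mem_closedBall.1 ((convex_closedBall c _).segment_subset ha.2 hb.2 hz)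
    rw [mul_div_assoc]
    linarith [dtm_le_add_dist (μ := μ) hm hp z c]
  have hdist : dist (γ a) (γ b) ≤ 80 * r / m := by
    rw [mul_div_assoc]
    linarith [dist_triangle_right (γ a) (γ b) c, mem_closedBall.1 ha.2, mem_closedBall.1 hb.2]
  refine (measure_mono hTsub).trans ((lengthMeasure_setOf_le_dtm_le hm hp hβ hadm.1 ha.1.1.1
    hab.le hb.1.1.2 hs).trans (ENNReal.ofReal_le_ofReal ?_))
  have haF : γ a ∈ F ∨ a = 0 := ha.1.2.imp_right fun h =>
    h.resolve_right fun h1 => absurd (hb.1.1.2) (not_le.2 (h1 ▸ hab))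
  have hbF : γ b ∈ F ∨ b = 1 := hb.1.2.imp_right fun h =>
    h.resolve_left fun h0 => absurd (ha.1.1.1) (not_le.2 (h0 ▸ hab))
  have := integral_geodesic_piece_le hm hp hβ hγ hab ha.1.1.1 hb.1.1.2 haF hbF hM
  gcongr
  exact this.trans (by gcongr)

lemma lengthMeasure_scaleTimes_le [IsProbabilityMeasure μ] (hm : m ∈ Ioo (0 : ℝ) 1)
    (hp : 1 ≤ p) (hβ : 0 ≤ β) (hγ : IsGeodesic m p β μ F x y γ) (hF : IsClosed F) {r ρ : ℝ}
    (hρ : 0 < ρ) (hr : 0 < r) :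
    lengthMeasure γ (scaleTimes m p μ F γ (r / ρ) r) ≤
      ENNReal.ofReal (160 * 49 ^ β * ρ ^ β / m ^ (2 + β) * r) := by
  have hm0 := hm.1
  obtain ⟨S, hS, hcov⟩ := exists_finset_cover_dtm_lt (μ := μ) (d := d) hm hp (r := 2 * r)
  have hsub : scaleTimes m p μ F γ (r / ρ) r ⊆
      ⋃ c ∈ S, scaleTimes m p μ F γ (r / ρ) r ∩ {t | dist (γ t) c < 8 * r} := by
    intro t ht
    obtain ⟨c, hc, htc⟩ := hcov (γ t) (by linarith [ht.2.2.2])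
    exact mem_iUnion₂.2 ⟨c, hc, ht, htc.trans_eq (by ring)⟩
  have hcard : (S.card : ℝ) ≤ 2 / m := by rwa [le_div_iff₀ hm0]
  calc lengthMeasure γ (scaleTimes m p μ F γ (r / ρ) r)
      ≤ ∑ _c ∈ S, ENNReal.ofReal ((49 * r / m) ^ β * (80 * r / m) / (r / ρ) ^ β) :=
        (measure_mono hsub).trans ((measure_biUnion_finset_le _ _).trans
          (Finset.sum_le_sum fun c _ =>
            lengthMeasure_scaleTimes_inter_le hm hp hβ hγ hF (by positivity) hr c))
    _ = ENNReal.ofReal (S.card * ((49 * r / m) ^ β * (80 * r / m) / (r / ρ) ^ β)) := by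
        rw [Finset.sum_const, nsmul_eq_mul, ENNReal.ofReal_mul (Nat.cast_nonneg _),
          ENNReal.ofReal_natCast]
    _ ≤ ENNReal.ofReal (2 / m * ((49 * r / m) ^ β * (80 * r / m) / (r / ρ) ^ β)) := by gcongr
    _ = ENNReal.ofReal (160 * 49 ^ β * ρ ^ β / m ^ (2 + β) * r) := by
        rw [Real.div_rpow (by positivity) hm0.le, Real.mul_rpow (by norm_num) hr.le,
          Real.div_rpow hr.le hρ.le, Real.rpow_add hm0, Real.rpow_two]
        have := Real.rpow_pos_of_pos hr β
        have := Real.rpow_pos_of_pos hρ β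
        have := Real.rpow_pos_of_pos hm0 β
        congr 1
        field_simp
        ring

lemma univ_subset_iUnion_scaleTimes [IsProbabilityMeasure μ] (hm : m ∈ Ioo (0 : ℝ) 1)
    (hp : 1 ≤ p) {r ρ : ℝ} (hρ : 1 < ρ) (hr : ∀ t ∈ Icc (0 : ℝ) 1, dtm m p μ (γ t) ≤ r) :
    univ ⊆ (Icc 0 1)ᶜ ∪ {t | γ t ∈ {z | dtm m p μ z = 0}} ∪
      (longJumpTimes m p μ F γ ∪ ⋃ n : ℕ, scaleTimes m p μ F γ (r / ρ ^ n / ρ) (r / ρ ^ n)) := by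
  intro t _
  by_cases ht : t ∈ Icc (0 : ℝ) 1
  swap
  · exact Or.inl (Or.inl ht)
  by_cases hlong : t ∈ longJumpTimes m p μ F γ
  · exact Or.inr (Or.inl hlong)
  rcases (dtm_nonneg (μ := μ) hm hp (γ t)).eq_or_lt' with h0 | hpos
  · exact Or.inl (Or.inr h0)
  obtain ⟨n, hn, hn'⟩ := exists_nat_pow_near ((one_le_div hpos).2 (hr t ht)) hρ
  have hρn : 0 < ρ ^ n := by positivity
  refine Or.inr (Or.inr (mem_iUnion.2 ⟨n, ht, hlong, ?_, ?_⟩))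
  · rw [div_div, ← pow_succ, div_le_iff₀ (by positivity), mul_comm]
    exact ((div_lt_iff₀ hpos).1 hn').le
  · rw [le_div_iff₀ hρn, mul_comm]
    exact (le_div_iff₀ hpos).1 hn

lemma eucLength_geodesic_le_of_dtm_le [IsProbabilityMeasure μ] (hm : m ∈ Ioo (0 : ℝ) 1)
    (hp : 1 ≤ p) (hβ : 0 ≤ β) (hγ : IsGeodesic m p β μ F x y γ) (hF : IsClosed F) {r ρ : ℝ}
    (hρ : 1 < ρ) (hr0 : 0 < r) (hr : ∀ t ∈ Icc (0 : ℝ) 1, dtm m p μ (γ t) ≤ r) :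
    eucLength γ ≤ 2 * (160 * 49 ^ β / m ^ (2 + β)) * ρ ^ (β + 1) / (ρ - 1) * r := by
  have hm0 := hm.1
  have hρ0 : 0 < ρ := one_pos.trans hρ
  obtain ⟨C, hC⟩ := hγ.1.1
  set A := 160 * 49 ^ β * ρ ^ β / m ^ (2 + β) with hA
  have hA0 : 0 ≤ A := by positivity
  have hgeom : HasSum (fun n : ℕ => A * (r / ρ ^ n)) (A * (r * (1 - ρ⁻¹)⁻¹)) := by
    simpa [div_eq_mul_inv] using
      ((hasSum_geometric_of_lt_one (inv_nonneg.2 hρ0.le) (inv_lt_one_of_one_lt₀ hρ)).mul_left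
        r).mul_left A
  have hscales : lengthMeasure γ (⋃ n : ℕ, scaleTimes m p μ F γ (r / ρ ^ n / ρ) (r / ρ ^ n)) ≤
      ENNReal.ofReal (A * (r * (1 - ρ⁻¹)⁻¹)) := by
    rw [← hgeom.tsum_eq, ENNReal.ofReal_tsum_of_nonneg (fun n => by positivity) hgeom.summable]
    exact (measure_iUnion_le _).trans (ENNReal.tsum_le_tsum fun n =>
      lengthMeasure_scaleTimes_le hm hp hβ hγ hF hρ0 (by positivity))
  have huniv : lengthMeasure γ univ ≤
      lengthMeasure γ (longJumpTimes m p μ F γ) + ENNReal.ofReal (A * (r * (1 - ρ⁻¹)⁻¹)) := by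
    have hnull : lengthMeasure γ ((Icc 0 1)ᶜ ∪ {t | γ t ∈ {z | dtm m p μ z = 0}}) = 0 :=
      measure_union_null (lengthMeasure_compl_Icc γ)
        (lengthMeasure_preimage_finite hC.continuous (finite_dtm_eq_zero hm hp))
    refine (measure_mono (univ_subset_iUnion_scaleTimes (F := F) hm hp hρ hr)).trans
      ((measure_union_le _ _).trans ?_)
    rw [hnull, zero_add]
    exact (measure_union_le _ _).trans (by gcongr)
  have hlong := two_mul_lengthMeasure_longJumpTimes_le (μ := μ) hm hp hγ.1 hF
  have hfin : lengthMeasure γ univ ≠ ∞ := by simp [lengthMeasure_univ hC]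
  have hfin' : lengthMeasure γ (longJumpTimes m p μ F γ) ≠ ∞ :=
    ((measure_mono (subset_univ _)).trans_lt hfin.lt_top).ne
  have hlen : (lengthMeasure γ univ).toReal = eucLength γ := by
    rw [lengthMeasure_univ hC]
    exact ENNReal.toReal_ofReal (integral_nonneg fun t => norm_nonneg _)
  have hρi : 0 < 1 - ρ⁻¹ := sub_pos.2 (inv_lt_one_of_one_lt₀ hρ)
  have h1 := ENNReal.toReal_mono (ENNReal.add_ne_top.2 ⟨hfin', ENNReal.ofReal_ne_top⟩) huniv
  rw [ENNReal.toReal_add hfin' ENNReal.ofReal_ne_top, ENNReal.toReal_ofReal (by positivity),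
    hlen] at h1
  have h2 := ENNReal.toReal_mono hfin hlong
  rw [ENNReal.toReal_mul, ENNReal.toReal_ofNat, hlen] at h2
  calc eucLength γ ≤ 2 * (A * (r * (1 - ρ⁻¹)⁻¹)) := by linarith
    _ = _ := by
        have : ρ - 1 ≠ 0 := (sub_pos.2 hρ).ne'
        rw [hA, Real.rpow_add_one hρ0.ne']
        have h : (1 - ρ⁻¹)⁻¹ = ρ / (ρ - 1) := by
          field_simp
        rw [h]
        ring

end Scales

theorem eucLength_geodesic_le_diam {d : ℕ} (m p β : ℝ) (hm : m ∈ Set.Ioo (0 : ℝ) 1) (hp : 1 ≤ p)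
    (hβ : 1 ≤ β) (K : Set (Euc d)) (hKc : IsCompact K) (hKconv : Convex ℝ K)
    (μ : Measure (Euc d)) [IsProbabilityMeasure μ] (hsupp : measSupport μ ⊆ K)
    (F : Set (Euc d)) (hFK : F ⊆ K) (hF : IsClosed F) (hFne : F.Nonempty)
    (x y : Euc d) (hx : x ∈ K) (hy : y ∈ K)
    (γ : ℝ → Euc d) (hγ : IsGeodesic m p β μ F x y γ) :
    eucLength γ ≤ fdtmConst m β * diam K := by
  have hm0 := hm.1
  have hβ0 : 0 ≤ β := by linarith
  have hρ : 1 < 1 + 32 / m := lt_add_of_pos_right 1 (by positivity)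
  have hρ' : 0 < 1 + 32 / m - 1 := sub_pos.2 hρ
  have hbound : ∀ r > diam K,
      eucLength γ ≤ 2 * (160 * 49 ^ β / m ^ (2 + β)) * (1 + 32 / m) ^ (β + 1) /
        (1 + 32 / m - 1) * r := by
    intro r hr
    have hr0 : 0 < r := diam_nonneg.trans_lt hr
    refine eucLength_geodesic_le_of_dtm_le hm hp hβ0 hγ hF hρ hr0 fun t ht => ?_
    refine dtm_le_of_measure_ball_eq_one hm hp hr0 (le_antisymm prob_le_one ?_)
    rw [← measure_eq_one_of_measSupport_subset hsupp]
    exact measure_mono fun z hz => mem_ball.2 ((dist_le_diam_of_mem hKc.isBounded hz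
      (hγ.1.mem_convex hF hKconv hFK hx hy ht)).trans_lt hr)
  have hlim : eucLength γ ≤ 2 * (160 * 49 ^ β / m ^ (2 + β)) * (1 + 32 / m) ^ (β + 1) /
      (1 + 32 / m - 1) * diam K :=
    ge_of_tendsto ((continuous_const.mul continuous_id).continuousWithinAt (s := Ioi (diam K))
      (x := diam K))
      (Filter.eventually_of_mem self_mem_nhdsWithin hbound)
  refine hlim.trans (mul_le_mul_of_nonneg_right ?_ diam_nonneg)
  rw [fdtmConst]
  have h : (160 : ℝ) * 49 ^ β ≤ 16 * 5 ^ β + 1152 * 165 ^ β := by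
    have h1 : (49 : ℝ) ^ β ≤ 165 ^ β := Real.rpow_le_rpow (by norm_num) (by norm_num) hβ0
    have h2 : (0 : ℝ) ≤ 5 ^ β := by positivity
    have h3 : (0 : ℝ) ≤ 49 ^ β := by positivity
    linarith
  gcongr

end
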